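/- arXiv:2106.11922 — 2 statements merged into one kernel-verified Lean document; each statement's English description precedes it below -/
import Mathlib

section
/- For every k ≥ 0, ∑_{ν partition : ν₁ ≤ k} z^{2·odd(ν')} q^{|ν|} = [qz² + 1]_{q²}^k / (q²;q²)_k. -/
/-- Integer partitions, encoded as weakly decreasing eventually-zero sequences
`ν₁ = f 0, ν₂ = f 1, …`. -/
abbrev YD : Type := {f : ℕ → ℕ // (∀ i j : ℕ, i ≤ j → f j ≤ f i) ∧ ∃ N, f N = 0}

/-- The size `|ν|` of a partition. -/
noncomputable def psize (f : ℕ → ℕ) : ℕ := ∑ᶠ i, f i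

/-- `conj f c` is the length `ν'_{c+1}` of the `(c+1)`-st column of the partition `f`. -/
noncomputable def conj (f : ℕ → ℕ) (c : ℕ) : ℕ := Nat.card {r : ℕ | c + 1 ≤ f r}

/-- `odd(ν')`: the number of odd-length columns of `ν`. -/
noncomputable def oddConj (f : ℕ → ℕ) : ℕ := Nat.card {c : ℕ | Odd (conj f c)}

/-- The q-Pochhammer symbol `(p;p)_m = ∏_{j=1}^m (1 - p^j)`. -/
def qPoch (p : ℂ) (m : ℕ) : ℂ := ∏ j ∈ Finset.range m, (1 - p ^ (j + 1))

/-- The Gaussian binomial coefficient `binom_p(k,j) = (p;p)_k / ((p;p)_j (p;p)_{k-j})`. -/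
noncomputable def gbinom (p : ℂ) (k j : ℕ) : ℂ := qPoch p k / (qPoch p j * qPoch p (k - j))

open Finset

/-- The sequence `a, f 0, f 1, …`: a new first row of length `a` on top of `f`. -/
def rowCons (a : ℕ) (f : ℕ → ℕ) : ℕ → ℕ
  | 0 => a
  | n + 1 => f n

@[simp] lemma rowCons_zero (a : ℕ) (f : ℕ → ℕ) : rowCons a f 0 = a := rfl

@[simp] lemma rowCons_succ (a : ℕ) (f : ℕ → ℕ) (n : ℕ) : rowCons a f (n + 1) = f n := rfl

lemma rowCons_injective (a : ℕ) : Function.Injective (rowCons a) := fun _ _ h =>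
  funext fun n => congrFun h (n + 1)

lemma psize_eq_sum_range {f : ℕ → ℕ} {N : ℕ} (h : ∀ i, N ≤ i → f i = 0) :
    psize f = ∑ i ∈ range N, f i := by
  refine finsum_eq_sum_of_support_subset _ fun i hi => ?_
  by_contra hn
  exact hi (h i (by simpa using hn))

lemma conj_eq_sum_range {f : ℕ → ℕ} {N : ℕ} (h : ∀ i, N ≤ i → f i = 0) (c : ℕ) :
    conj f c = ∑ i ∈ range N, if c + 1 ≤ f i then 1 else 0 := by
  have hs : {r : ℕ | c + 1 ≤ f r} = ((range N).filter fun r => c + 1 ≤ f r : Finset ℕ) := by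
    ext r
    have := h r
    simp only [Set.mem_ofPred_eq, coe_filter, mem_range]
    grind
  rw [conj, hs, Nat.card_coe_set_eq, Set.ncard_coe_finset, card_filter]

lemma YD.eventually_zero (f : YD) : ∃ N, ∀ i, N ≤ i → f.val i = 0 := by
  obtain ⟨N, hN⟩ := f.2.2
  exact ⟨N, fun i hi => Nat.le_zero.mp ((f.2.1 N i hi).trans_eq hN)⟩

lemma rowCons_eventually_zero {f : ℕ → ℕ} {N : ℕ} (h : ∀ i, N ≤ i → f i = 0) (a : ℕ) :
    ∀ i, N + 1 ≤ i → rowCons a f i = 0 := by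
  rintro (_ | i) hi
  · omega
  · exact h i (by omega)

lemma psize_rowCons (f : YD) (a : ℕ) : psize (rowCons a f.val) = a + psize f.val := by
  obtain ⟨N, hN⟩ := f.eventually_zero
  rw [psize_eq_sum_range hN, psize_eq_sum_range (rowCons_eventually_zero hN a), sum_range_succ']
  simp [add_comm]

lemma conj_rowCons (f : YD) {a c : ℕ} (h : c < a) :
    conj (rowCons a f.val) c = conj f.val c + 1 := by
  obtain ⟨N, hN⟩ := f.eventually_zero
  rw [conj_eq_sum_range hN, conj_eq_sum_range (rowCons_eventually_zero hN a), sum_range_succ']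
  simp [Nat.succ_le_of_lt h]

lemma conj_eq_zero (f : YD) {c : ℕ} (h : f.val 0 ≤ c) : conj f.val c = 0 := by
  have : {r : ℕ | c + 1 ≤ f.val r} = ∅ := by
    ext r
    have := f.2.1 0 r (Nat.zero_le r)
    simp
    omega
  rw [conj, this]
  simp

/-- Adding a row of length `a` to a partition with first part at most `a`. -/
def YD.cons (a : ℕ) (f : {f : YD // f.val 0 ≤ a}) : {f : YD // f.val 0 ≤ a} :=
  ⟨⟨rowCons a f.val.val, by
    rintro (_ | i) (_ | j) hij
    · simp
    · simpa using (f.val.2.1 0 j (Nat.zero_le j)).trans f.2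
    · omega
    · simpa using f.val.2.1 i j (by omega), by
    obtain ⟨N, hN⟩ := f.val.2.2
    exact ⟨N + 1, hN⟩⟩, le_rfl⟩

lemma YD.cons_injective (a : ℕ) : Function.Injective (YD.cons a) := fun _ _ h =>
  Subtype.ext <| Subtype.ext <| rowCons_injective a <|
    congrArg (fun t : {f : YD // f.val 0 ≤ a} => t.val.val) h

/-- Every partition with `ν₁ ≤ k + 1` arises in exactly one way by adding `m` rows of length `k + 1`
to a partition with `ν₁ ≤ k`. -/
def YD.addRows (k : ℕ) (p : {f : YD // f.val 0 ≤ k} × ℕ) : {f : YD // f.val 0 ≤ k + 1} :=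
  (YD.cons (k + 1))^[p.2] ⟨p.1.val, p.1.2.trans k.le_succ⟩

lemma YD.addRows_succ (k : ℕ) (f : {f : YD // f.val 0 ≤ k}) (m : ℕ) :
    YD.addRows k (f, m + 1) = YD.cons (k + 1) (YD.addRows k (f, m)) :=
  Function.iterate_succ_apply' _ _ _

lemma YD.addRows_zero_ne_succ (k : ℕ) (f g : {f : YD // f.val 0 ≤ k}) (m : ℕ) :
    YD.addRows k (f, 0) ≠ YD.addRows k (g, m + 1) := by
  intro h
  rw [YD.addRows_succ] at h
  have h0 : f.val.val 0 = k + 1 :=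
    congrArg (fun t : {f : YD // f.val 0 ≤ k + 1} => t.val.val 0) h
  have := f.2
  omega

lemma YD.addRows_injective (k : ℕ) : Function.Injective (YD.addRows k) := by
  rintro ⟨f, m⟩ ⟨g, n⟩ h
  induction m generalizing n with
  | zero =>
    cases n with
    | zero =>
      have : f.val = g.val := congrArg (fun t : {f : YD // f.val 0 ≤ k + 1} => t.val) h
      rw [Subtype.ext this]
    | succ n => exact absurd h (YD.addRows_zero_ne_succ k f g n)
  | succ m ih =>
    cases n with
    | zero => exact absurd h.symm (YD.addRows_zero_ne_succ k g f m)
    | succ n =>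
      rw [YD.addRows_succ, YD.addRows_succ] at h
      have := ih n (YD.cons_injective _ h)
      simp_all

lemma YD.addRows_surjective (k : ℕ) : Function.Surjective (YD.addRows k) := by
  suffices H : ∀ N, ∀ f : {f : YD // f.val 0 ≤ k + 1}, f.val.val N = 0 →
      ∃ p, YD.addRows k p = f by
    intro f
    obtain ⟨N, hN⟩ := f.val.2.2
    exact H N f hN
  intro N
  induction N with
  | zero => exact fun f hf => ⟨(⟨f.val, by omega⟩, 0), rfl⟩
  | succ N ih =>
    intro f hf
    by_cases h0 : f.val.val 0 ≤ k
    · exact ⟨(⟨f.val, h0⟩, 0), rfl⟩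
    · obtain ⟨⟨g, m⟩, hg⟩ := ih ⟨⟨fun i => f.val.val (i + 1),
        fun i j hij => f.val.2.1 _ _ (by omega), N, hf⟩,
        (f.val.2.1 0 1 (by omega)).trans f.2⟩ hf
      refine ⟨(g, m + 1), ?_⟩
      rw [YD.addRows_succ, hg]
      refine Subtype.ext (Subtype.ext (funext fun i => ?_))
      cases i with
      | zero =>
        have := f.2
        change k + 1 = f.val.val 0
        omega
      | succ i => rfl

/-- The weight of a partition with at most `k` columns (some possibly empty): `x` for each column of
odd length, `y` for each column of even length, and `q` for each box. -/
noncomputable def colWeight (q : ℂ) (k : ℕ) (x y : ℂ) (f : ℕ → ℕ) : ℂ :=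
  (∏ c ∈ range k, if Odd (conj f c) then x else y) * q ^ psize f

lemma colWeight_succ (q : ℂ) {k : ℕ} (x y : ℂ) (f : YD) (h : f.val 0 ≤ k) :
    colWeight q (k + 1) x y f.val = y * colWeight q k x y f.val := by
  rw [colWeight, colWeight, prod_range_succ, conj_eq_zero f h]
  simp
  ring

lemma colWeight_cons (q : ℂ) (k : ℕ) (x y : ℂ) (f : {f : YD // f.val 0 ≤ k}) :
    colWeight q k x y (YD.cons k f).val.val = q ^ k * colWeight q k y x f.val.val := by
  have h : ∀ c ∈ range k, (if Odd (conj (YD.cons k f).val.val c) then x else y) =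
      if Odd (conj f.val.val c) then y else x := by
    intro c hc
    rw [show conj (YD.cons k f).val.val c = conj f.val.val c + 1 from
      conj_rowCons f.val (mem_range.mp hc)]
    simp only [Nat.odd_add_one, ite_not]
  rw [colWeight, colWeight, prod_congr rfl h,
    show psize (YD.cons k f).val.val = k + psize f.val.val from psize_rowCons f.val k, pow_add]
  ring

lemma colWeight_addRows (q : ℂ) (k : ℕ) (x y : ℂ) (f : {f : YD // f.val 0 ≤ k}) (m : ℕ) :
    colWeight q (k + 1) x y (YD.addRows k (f, m)).val.val =
      (if Even m then (q ^ (k + 1)) ^ m else 0) * (y * colWeight q k x y f.val.val) +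
      (if Even m then 0 else (q ^ (k + 1)) ^ m) * (x * colWeight q k y x f.val.val) := by
  induction m generalizing x y with
  | zero => simpa [YD.addRows] using colWeight_succ q x y f.val f.2
  | succ m ih =>
    rw [YD.addRows_succ, colWeight_cons, ih]
    by_cases h : Even m <;> simp [h, Nat.even_add_one] <;> ring

lemma qPoch_succ (p : ℂ) (m : ℕ) : qPoch p (m + 1) = qPoch p m * (1 - p ^ (m + 1)) :=
  prod_range_succ _ _

lemma one_sub_pow_ne_zero {p : ℂ} (hp : ‖p‖ < 1) {m : ℕ} (hm : m ≠ 0) : 1 - p ^ m ≠ 0 := by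
  intro h
  have := pow_lt_one₀ (norm_nonneg p) hp hm
  rw [← norm_pow, ← sub_eq_zero.mp h, norm_one] at this
  exact lt_irrefl _ this

lemma qPoch_ne_zero {p : ℂ} (hp : ‖p‖ < 1) (m : ℕ) : qPoch p m ≠ 0 :=
  prod_ne_zero_iff.mpr fun _ _ => one_sub_pow_ne_zero hp (Nat.succ_ne_zero _)

/-- The polynomial `[qx + y]_{q²}^k / (q²;q²)_k`. -/
noncomputable def colSum (q : ℂ) (k : ℕ) (x y : ℂ) : ℂ :=
  ∑ a ∈ antidiagonal k, (q * x) ^ a.1 * y ^ a.2 / (qPoch (q ^ 2) a.1 * qPoch (q ^ 2) a.2)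

lemma one_sub_pow_mul_colSum {q : ℂ} (hq : ‖q‖ < 1) (k : ℕ) (x y : ℂ) :
    (1 - (q ^ 2) ^ (k + 1)) * colSum q (k + 1) x y =
      y * colSum q k x y + q ^ (k + 1) * (x * colSum q k y x) := by
  have hp : ‖q ^ 2‖ < 1 := by
    rw [norm_pow]
    exact pow_lt_one₀ (norm_nonneg q) hq two_ne_zero
  set t : ℕ × ℕ → ℂ := fun a =>
    (q * x) ^ a.1 * y ^ a.2 / (qPoch (q ^ 2) a.1 * qPoch (q ^ 2) a.2) with ht
  have hsplit : (1 - (q ^ 2) ^ (k + 1)) * colSum q (k + 1) x y =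
      ∑ a ∈ antidiagonal (k + 1), (1 - (q ^ 2) ^ a.2) * t a +
      ∑ a ∈ antidiagonal (k + 1), (q ^ 2) ^ a.2 * (1 - (q ^ 2) ^ a.1) * t a := by
    rw [colSum, mul_sum, ← sum_add_distrib]
    refine sum_congr rfl fun a ha => ?_
    rw [← mem_antidiagonal.mp ha, pow_add, ht]
    ring
  rw [hsplit, Nat.sum_antidiagonal_succ', Nat.sum_antidiagonal_succ]
  simp only [pow_zero, sub_self, zero_mul, mul_zero, zero_add]
  congr 1
  · rw [colSum, mul_sum]
    refine sum_congr rfl fun a _ => ?_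
    have h1 := qPoch_ne_zero hp a.1
    have h2 := qPoch_ne_zero hp a.2
    have h3 := one_sub_pow_ne_zero hp (Nat.succ_ne_zero a.2)
    simp only [ht, qPoch_succ, Nat.succ_eq_add_one] at h3 ⊢
    field_simp
    ring
  · rw [colSum, ← Nat.sum_antidiagonal_swap, mul_sum, mul_sum]
    refine sum_congr rfl fun a ha => ?_
    have h1 := qPoch_ne_zero hp a.1
    have h2 := qPoch_ne_zero hp a.2
    have h3 := one_sub_pow_ne_zero hp (Nat.succ_ne_zero a.2)
    rw [← mem_antidiagonal.mp ha]
    simp only [ht, qPoch_succ, Nat.succ_eq_add_one, Prod.fst_swap, Prod.snd_swap] at h3 ⊢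
    rw [mul_div_assoc', mul_div_assoc', mul_div_assoc', div_eq_div_iff
      (mul_ne_zero (mul_ne_zero h2 h3) h1) (mul_ne_zero h1 h2)]
    ring

lemma hasSum_even_pow {r : ℂ} (hr : ‖r‖ < 1) :
    HasSum (fun m => if Even m then r ^ m else 0) (1 - r ^ 2)⁻¹ := by
  have h2 : ‖r ^ 2‖ < 1 := by
    rw [norm_pow]
    exact pow_lt_one₀ (norm_nonneg r) hr two_ne_zero
  rw [← add_zero (1 - r ^ 2)⁻¹]
  refine HasSum.even_add_odd ?_ ?_
  · simpa [pow_mul] using hasSum_geometric_of_norm_lt_one h2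
  · simp [hasSum_zero]

lemma hasSum_odd_pow {r : ℂ} (hr : ‖r‖ < 1) :
    HasSum (fun m => if Even m then 0 else r ^ m) (r * (1 - r ^ 2)⁻¹) := by
  have h2 : ‖r ^ 2‖ < 1 := by
    rw [norm_pow]
    exact pow_lt_one₀ (norm_nonneg r) hr two_ne_zero
  rw [← zero_add (r * _)]
  refine HasSum.even_add_odd ?_ ?_
  · simp [hasSum_zero]
  · have h (m : ℕ) : (if Even (2 * m + 1) then 0 else r ^ (2 * m + 1)) = r * (r ^ 2) ^ m := by
      rw [if_neg (by simp), pow_succ', pow_mul]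
    simpa only [h] using (hasSum_geometric_of_norm_lt_one h2).mul_left r

lemma HasSum.mul_prod {α β : Type*} {f : α → ℂ} {g : β → ℂ} {a b : ℂ}
    (hf : HasSum f a) (hg : HasSum g b) :
    HasSum (fun p : α × β => g p.2 * f p.1) (b * a) := by
  simpa only [mul_comm] using
    hf.mul hg (summable_mul_of_summable_norm hf.summable.norm hg.summable.norm)

theorem hasSum_colWeight {q : ℂ} (hq : ‖q‖ < 1) (k : ℕ) (x y : ℂ) :
    HasSum (fun f : {f : YD // f.val 0 ≤ k} => colWeight q k x y f.val.val) (colSum q k x y) := by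
  induction k generalizing x y with
  | zero =>
    let e : {f : YD // f.val 0 ≤ 0} := ⟨⟨fun _ => 0, fun _ _ _ => le_rfl, 0, rfl⟩, le_rfl⟩
    have he : ∀ f, f = e := fun f => Subtype.ext <| Subtype.ext <| funext fun i =>
      Nat.le_zero.mp ((f.val.2.1 0 i (Nat.zero_le i)).trans f.2)
    have h1 : colSum q 0 x y = colWeight q 0 x y e.val.val := by
      simp [colSum, colWeight, qPoch, psize, e]
    rw [h1]
    exact hasSum_single e fun f hf => absurd (he f) hf
  | succ k ih =>
    have hr : ‖q ^ (k + 1)‖ < 1 := by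
      rw [norm_pow]
      exact pow_lt_one₀ (norm_nonneg q) hq k.succ_ne_zero
    have hne : 1 - (q ^ (k + 1)) ^ 2 ≠ 0 := one_sub_pow_ne_zero hr two_ne_zero
    have hsum := (((ih x y).mul_left y).mul_prod (hasSum_even_pow hr)).add
      (((ih y x).mul_left x).mul_prod (hasSum_odd_pow hr))
    rw [← (Equiv.ofBijective _ ⟨YD.addRows_injective k, YD.addRows_surjective k⟩).hasSum_iff]
    convert hsum using 1
    · exact funext fun p => colWeight_addRows q k x y p.1 p.2
    · have h := one_sub_pow_mul_colSum hq k x y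
      rw [show (q ^ 2) ^ (k + 1) = (q ^ (k + 1)) ^ 2 by ring] at h
      rw [← mul_right_inj' hne, h]
      field_simp

lemma oddConj_eq_card (f : YD) {k : ℕ} (h : f.val 0 ≤ k) :
    oddConj f.val = #{c ∈ range k | Odd (conj f.val c)} := by
  have hs : {c : ℕ | Odd (conj f.val c)} =
      ((range k).filter fun c => Odd (conj f.val c) : Finset ℕ) := by
    ext c
    simp only [Set.mem_ofPred_eq, coe_filter, mem_range, iff_and_self]
    intro hc
    by_contra hk
    simp [conj_eq_zero f (h.trans (not_lt.mp hk))] at hc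
  rw [oddConj, hs, Nat.card_coe_set_eq, Set.ncard_coe_finset]

lemma colWeight_sq_one (q z : ℂ) (f : YD) {k : ℕ} (h : f.val 0 ≤ k) :
    colWeight q k (z ^ 2) 1 f.val = z ^ (2 * oddConj f.val) * q ^ psize f.val := by
  rw [colWeight, prod_ite, prod_const, prod_const_one, mul_one, oddConj_eq_card f h, pow_mul]

/-- Lemma (g̃_k formula): for every k ≥ 0,
∑_{ν : ν₁ ≤ k} z^{2·odd(ν')} q^{|ν|} = [qz² + 1]_{q²}^k / (q²;q²)_k,
where [A+B]_p^k = ∑_{j=0}^k A^j B^{k-j} binom_p(k,j). -/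
theorem gtilde_formula (q z : ℂ) (hq : ‖q‖ < 1) (k : ℕ) :
    ∑' ν : {ν : YD // ν.val 0 ≤ k},
        z ^ (2 * oddConj ν.val.val) * q ^ psize ν.val.val
      = (∑ j ∈ Finset.range (k + 1),
            (q * z ^ 2) ^ j * (1 : ℂ) ^ (k - j) * gbinom (q ^ 2) k j)
          / qPoch (q ^ 2) k := by
  have hp : ‖q ^ 2‖ < 1 := by
    rw [norm_pow]
    exact pow_lt_one₀ (norm_nonneg q) hq two_ne_zero
  have hk := qPoch_ne_zero hp k
  rw [tsum_congr fun ν : {ν : YD // ν.val 0 ≤ k} => (colWeight_sq_one q z ν.val ν.2).symm,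
    (hasSum_colWeight hq k (z ^ 2) 1).tsum_eq, colSum,
    Finset.Nat.sum_antidiagonal_eq_sum_range_succ_mk, Finset.sum_div]
  refine Finset.sum_congr rfl fun j _ => ?_
  rw [gbinom]
  field_simp
end

section
/- The operations ι₁ and ι₂ (internal insertion with cycling) commute: ι₁ ∘ ι₂ = ι₂ ∘ ι₁ as maps on pairs of semi-standard skew tableaux of the same shape (equivalently on pairs of row-coordinate matrices in M_n). -/
/-- A (generalized) filled skew tableau: `lam r` / `rho r` are the outer and inner
shape of row `r ∈ ℤ`, and `ent r c` is the entry in row `r` and (0-based) column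
`c`, with `0` denoting an empty cell. -/
structure Tab where
  lam : ℤ → ℕ
  rho : ℤ → ℕ
  ent : ℤ → ℕ → ℕ

/-- The cell `(r,c)` belongs to the skew shape of `T`. -/
def inSh (T : Tab) (r : ℤ) (c : ℕ) : Prop := T.rho r ≤ c ∧ c < T.lam r

/-- `lam/rho` is a (generalized) skew Young diagram. -/
def validShape (T : Tab) : Prop :=
  ∃ r0 N : ℤ,
    (∀ r : ℤ, r < r0 → T.lam r = 0 ∧ T.rho r = 0) ∧
    (∀ r r' : ℤ, r0 ≤ r → r ≤ r' → T.lam r' ≤ T.lam r ∧ T.rho r' ≤ T.rho r) ∧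
    (∀ r : ℤ, N ≤ r → T.lam r = 0) ∧
    (∀ r : ℤ, T.rho r ≤ T.lam r)

/-- Semistandard skew tableau with entries in `{1,…,n}`. -/
def isSSYT (n : ℕ) (T : Tab) : Prop :=
  validShape T ∧
  (∀ r c, T.ent r c ≠ 0 ↔ inSh T r c) ∧
  (∀ r c, T.ent r c ≤ n) ∧
  (∀ (r : ℤ) (c c' : ℕ), T.rho r ≤ c → c ≤ c' → c' < T.lam r →
    T.ent r c ≤ T.ent r c') ∧
  (∀ r c, inSh T r c → inSh T (r + 1) c → T.ent r c < T.ent (r + 1) c)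

/-- Rows `≥ rMax T` are empty. -/
noncomputable def rMax (T : Tab) : ℤ := sInf {m : ℤ | ∀ r : ℤ, m ≤ r → T.lam r = 0}

/-- Rows `< rMin T` are empty. -/
noncomputable def rMin (T : Tab) : ℤ := sSup {m : ℤ | ∀ r : ℤ, r < m → T.lam r = 0}

/-- Schensted bumping of a value `v` into row `r` (and, recursively, below):
`v` replaces the entry of the leftmost cell of row `r` whose entry exceeds `v`,
which is in turn bumped to the next row; if no such cell exists, `v` is appended
at the right end of row `r`.  `fuel` bounds the recursion depth. -/
def bump : ℕ → Tab → ℤ → ℕ → Tab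
  | 0, T, _, _ => T
  | fuel + 1, T, r, v =>
    let bigger := (Finset.Ico (T.rho r) (T.lam r)).filter fun c => v < T.ent r c
    if h : bigger.Nonempty then
      let c := bigger.min' h
      let w := T.ent r c
      bump fuel
        { lam := T.lam, rho := T.rho,
          ent := fun r' c' => if r' = r ∧ c' = c then v else T.ent r' c' }
        (r + 1) w
    else
      { lam := fun r' => if r' = r then T.lam r + 1 else T.lam r',
        rho := T.rho,
        ent := fun r' c' => if r' = r ∧ c' = T.lam r then v else T.ent r' c' }

/-- The internal insertion `R_{[r]}`: vacate the leftmost cell of row `r` and insert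
its value in the row below, following Schensted's bumping algorithm.  If row `r`
consists only of empty cells, an extra empty cell is created at row `r`. -/
noncomputable def intIns (T : Tab) (r : ℤ) : Tab :=
  if T.rho r < T.lam r then
    bump ((rMax T - r).toNat + 2)
      { lam := T.lam,
        rho := fun r' => if r' = r then T.rho r + 1 else T.rho r',
        ent := fun r' c' => if r' = r ∧ c' = T.rho r then 0 else T.ent r' c' }
      (r + 1) (T.ent r (T.rho r))
  else
    { lam := fun r' => if r' = r then T.lam r + 1 else T.lam r',
      rho := fun r' => if r' = r then T.rho r + 1 else T.rho r',
      ent := T.ent }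

/-- The number of `1`-cells in row `r` of `Q`. -/
def ones (Q : Tab) (r : ℤ) : ℕ :=
  ((Finset.Ico (Q.rho r) (Q.lam r)).filter fun c => Q.ent r c = 1).card

/-- Internal insertion with cycling `ι₂`: apply internal insertions to `P` at the
rows of the `1`-cells of `Q` (in weakly decreasing order of rows), and let the new
recording tableau be obtained from `Q` by deleting all `1`-cells, decreasing all
remaining labels by `1`, and adding `n`-cells to match the shape of the new
insertion tableau. -/
noncomputable def iota2 (n : ℕ) (PQ : Tab × Tab) : Tab × Tab :=
  let P := PQ.1
  let Q := PQ.2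
  let rows : List ℤ :=
    (List.range (rMax Q - rMin Q).toNat).map fun t => rMax Q - 1 - (t : ℤ)
  let P' := rows.foldl (fun S r => (fun S' => intIns S' r)^[ones Q r] S) P
  let Q' : Tab :=
    { lam := P'.lam, rho := P'.rho,
      ent := fun r c =>
        if P'.rho r ≤ c ∧ c < P'.lam r then
          if Q.rho r + ones Q r ≤ c ∧ c < Q.lam r then Q.ent r c - 1 else n
        else 0 }
  (P', Q')

def swapP (PQ : Tab × Tab) : Tab × Tab := (PQ.2, PQ.1)

/-- `ι₁ := swap ∘ ι₂ ∘ swap`. -/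
noncomputable def iota1 (n : ℕ) (PQ : Tab × Tab) : Tab × Tab :=
  swapP (iota2 n (swapP PQ))

theorem level_le {M : ℕ → ℤ → ℕ} (hM : Monotone M) {i k : ℕ} (h : i ≤ k) (r : ℤ) :
    M i r ≤ M k r :=
  hM h r

/-- The filled tableau whose entries `≤ i` fill row `r` up to column `M i r`. -/
def ofChain (n : ℕ) (M : ℕ → ℤ → ℕ) : Tab where
  lam := M n
  rho := M 0
  ent := fun r c => if c < M n r then ((Finset.range n).filter fun i => M i r ≤ c).card else 0

theorem ofChain_ent_le_iff {n : ℕ} {M : ℕ → ℤ → ℕ} (hM : Monotone M) {r : ℤ} {c : ℕ}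
    (hc : c < M n r) (i : ℕ) : (ofChain n M).ent r c ≤ i ↔ c < M i r := by
  simp only [ofChain, if_pos hc]
  constructor
  · intro h
    by_contra! hi
    have hin : i < n := by
      by_contra! hni
      have := level_le hM hni r
      omega
    have hsub : Finset.range (i + 1) ⊆ (Finset.range n).filter fun i => M i r ≤ c := by
      intro k hk
      simp only [Finset.mem_range, Finset.mem_filter] at hk ⊢
      have := level_le hM (show k ≤ i by omega) r
      exact ⟨by omega, by omega⟩
    have := Finset.card_le_card hsub
    simp only [Finset.card_range] at this
    omega
  · intro h
    have hsub : ((Finset.range n).filter fun i => M i r ≤ c) ⊆ Finset.range i := by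
      intro k hk
      simp only [Finset.mem_range, Finset.mem_filter] at hk ⊢
      by_contra! hki
      have := level_le hM hki r
      omega
    simpa using Finset.card_le_card hsub

theorem ofChain_ent_eq {n : ℕ} {M : ℕ → ℤ → ℕ} (hM : Monotone M) {r : ℤ} {c v : ℕ}
    (hc : c < M n r) (hv : v ≤ n) (h : ∀ i ≤ n, v ≤ i ↔ c < M i r) :
    (ofChain n M).ent r c = v := by
  refine le_antisymm ((ofChain_ent_le_iff hM hc v).2 ((h v hv).1 le_rfl)) ?_
  by_contra! hlt
  have := (ofChain_ent_le_iff hM hc _).1 le_rfl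
  have := (h _ (by omega)).2 this
  omega

theorem ofChain_ent_le {n : ℕ} {M : ℕ → ℤ → ℕ} (hM : Monotone M) {r : ℤ} {c : ℕ} :
    (ofChain n M).ent r c ≤ n := by
  by_cases hc : c < M n r
  · exact (ofChain_ent_le_iff hM hc n).2 hc
  · simp [ofChain, hc]

theorem ofChain_ent_of_le {n : ℕ} {M : ℕ → ℤ → ℕ} {r : ℤ} {c : ℕ} (hc : M n r ≤ c) :
    (ofChain n M).ent r c = 0 := by
  simp [ofChain, hc]

/-- A tableau agrees with `ofChain n M` as soon as its entries are given by the levels of `M`. -/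
theorem eq_ofChain {n : ℕ} {M : ℕ → ℤ → ℕ} (hM : Monotone M) {T : Tab} (hlam : T.lam = M n)
    (hrho : T.rho = M 0) (hout : ∀ r c, M n r ≤ c → T.ent r c = 0)
    (hin : ∀ r c, c < M n r → T.ent r c ≤ n ∧ ∀ i ≤ n, T.ent r c ≤ i ↔ c < M i r) :
    T = ofChain n M := by
  obtain ⟨lam, rho, ent⟩ := T
  simp only at hlam hrho hout hin
  subst hlam hrho
  have : ent = (ofChain n M).ent := by
    funext r c
    by_cases hc : c < M n r
    · exact (ofChain_ent_eq hM hc (hin r c hc).1 (hin r c hc).2).symm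
    · rw [hout r c (by omega), ofChain_ent_of_le (by omega)]
  rw [this]
  rfl

theorem ofChain_congr {n : ℕ} {M N : ℕ → ℤ → ℕ} (h : ∀ i ≤ n, M i = N i) :
    ofChain n M = ofChain n N := by
  have h0 := h 0 (Nat.zero_le n)
  have hn := h n le_rfl
  simp only [ofChain, h0, hn, Tab.mk.injEq, true_and]
  funext r c
  congr 2
  apply Finset.filter_congr
  intro i hi
  rw [h i (Finset.mem_range.1 hi).le]

/-- `p i` is the row of the box added at level `i`, for all levels from `v` on. -/
def IsPath (M : ℕ → ℤ → ℕ) (v : ℕ) (p : ℕ → ℤ) : Prop :=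
  ∀ i, v ≤ i → p (i + 1) = if M i (p i) < M (i + 1) (p i) then p i + 1 else p i

/-- Add to the levels `≥ v` a box in the row given by `p`. -/
def addPath (M : ℕ → ℤ → ℕ) (v : ℕ) (p : ℕ → ℤ) : ℕ → ℤ → ℕ :=
  fun i r => M i r + if v ≤ i ∧ r = p i then 1 else 0

/-- Add to the levels in `[v, w)` a box in row `j`. -/
def addBox (M : ℕ → ℤ → ℕ) (v w : ℕ) (j : ℤ) : ℕ → ℤ → ℕ :=
  fun i r => M i r + if v ≤ i ∧ i < w ∧ r = j then 1 else 0

theorem addPath_mono {M : ℕ → ℤ → ℕ} (hM : Monotone M) {v : ℕ} {p : ℕ → ℤ}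
    (hp : IsPath M v p) : Monotone (addPath M v p) := by
  refine monotone_nat_of_le_succ fun i r => ?_
  have h1 := level_le hM (Nat.le_succ i) r
  simp only [addPath]
  simp only [Nat.succ_eq_add_one] at h1
  by_cases hi : v ≤ i ∧ r = p i
  · obtain ⟨hv, rfl⟩ := hi
    have := hp i hv
    split_ifs at this ⊢ <;> grind
  · rw [if_neg hi]
    omega

theorem addBox_mono {M : ℕ → ℤ → ℕ} (hM : Monotone M) {v w : ℕ} {j : ℤ}
    (hw : M v j < M w j) (hlt : ∀ i < w, M i j ≤ M v j) : Monotone (addBox M v w j) := by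
  refine monotone_nat_of_le_succ fun i r => ?_
  have h1 := level_le hM (Nat.le_succ i) r
  simp only [addBox]
  simp only [Nat.succ_eq_add_one] at h1
  by_cases hi : v ≤ i ∧ i < w ∧ r = j
  · obtain ⟨hv, hiw, rfl⟩ := hi
    have := hlt i hiw
    rcases Nat.lt_or_ge (i + 1) w with h | h
    · grind
    · have : i + 1 = w := by omega
      grind
  · rw [if_neg hi]
    omega

theorem IsPath.const {M : ℕ → ℤ → ℕ} (hM : Monotone M) {v w : ℕ} {p : ℕ → ℤ}
    (hp : IsPath M v p) (hlt : ∀ i < w, M i (p v) ≤ M v (p v)) {i : ℕ} (hv : v ≤ i) (hw : i < w) :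
    p i = p v := by
  induction i, hv using Nat.le_induction with
  | base => rfl
  | succ i hv ih =>
    have h1 := ih (by omega)
    have h2 := hp i hv
    have h3 := hlt (i + 1) hw
    have h4 := level_le hM hv (p v)
    rw [h1, if_neg (by omega)] at h2
    exact h2

theorem IsPath.jump {M : ℕ → ℤ → ℕ} (hM : Monotone M) {v w : ℕ} {p : ℕ → ℤ}
    (hp : IsPath M v p) (hw : M v (p v) < M w (p v))
    (hlt : ∀ i < w, M i (p v) ≤ M v (p v)) : p w = p v + 1 := by
  have hvw : v < w := by
    by_contra! h
    have := level_le hM h (p v)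
    omega
  obtain ⟨u, rfl⟩ : ∃ u, w = u + 1 := ⟨w - 1, by omega⟩
  have h1 := hp.const hM hlt (show v ≤ u by omega) (by omega)
  have h2 := hp u (by omega)
  have h3 := hlt u (by omega)
  rw [h1, if_pos (by omega)] at h2
  exact h2

theorem IsPath.addBox {M : ℕ → ℤ → ℕ} {v w : ℕ} {j : ℤ} {p : ℕ → ℤ} (hvw : v ≤ w)
    (hp : IsPath M v p) : IsPath (addBox M v w j) w p := by
  intro i hi
  rw [hp i (by omega)]
  have h1 : ¬ (i < w) := by omega
  have h2 : ¬ (i + 1 < w) := by omega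
  simp [_root_.addBox, h1, h2]

theorem addPath_addBox {M : ℕ → ℤ → ℕ} (hM : Monotone M) {v w : ℕ} {p : ℕ → ℤ} (hvw : v ≤ w)
    (hp : IsPath M v p) (hlt : ∀ i < w, M i (p v) ≤ M v (p v)) :
    addPath (addBox M v w (p v)) w p = addPath M v p := by
  funext i r
  simp only [addPath, addBox]
  rcases Nat.lt_or_ge i w with h | h
  · by_cases hv : v ≤ i
    · rw [hp.const hM hlt hv h]
      grind
    · grind
  · grind

theorem append_ofChain {n : ℕ} {M : ℕ → ℤ → ℕ} {v : ℕ} {p : ℕ → ℤ} (hM : Monotone M)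
    (hp : IsPath M v p) (hv : v ≤ n) (hrow : M n (p v) ≤ M v (p v)) {T : Tab}
    (hlam : T.lam = fun r => if r = p v then M n (p v) + 1 else M n r)
    (hrho : T.rho = addPath M v p 0)
    (hent : ∀ r c, T.ent r c = if r = p v ∧ c = M n (p v) then v else (ofChain n M).ent r c) :
    T = ofChain n (addPath M v p) := by
  have hconst : ∀ i, v ≤ i → i ≤ n → p i = p v := fun i hi hin =>
    hp.const (w := n + 1) hM
      (fun k hk => (level_le hM (show k ≤ n by omega) (p v)).trans hrow) hi (by omega)
  refine eq_ofChain (addPath_mono hM hp) ?_ hrho ?_ ?_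
  · rw [hlam]
    funext r
    simp only [addPath, hconst n hv le_rfl]
    grind
  · intro r c hc
    simp only [addPath, hconst n hv le_rfl] at hc
    rw [hent, if_neg (by grind), ofChain_ent_of_le (by omega)]
  · intro r c hc
    simp only [addPath, hconst n hv le_rfl] at hc
    rw [hent]
    split_ifs with h
    · obtain ⟨rfl, rfl⟩ := h
      refine ⟨hv, fun i hi => ?_⟩
      have := level_le hM hi (p v)
      constructor
      · intro hvi
        have := level_le hM hvi (p v)
        simp only [addPath, hconst i hvi hi]
        grind
      · simp only [addPath]
        grind
    · have hc' : c < M n r := by grind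
      refine ⟨ofChain_ent_le hM, fun i hi => ?_⟩
      rw [ofChain_ent_le_iff hM hc']
      simp only [addPath]
      by_cases hvi : v ≤ i ∧ r = p i
      · have h1 := hconst i hvi.1 hi
        have h2 := level_le hM hvi.1 (p v)
        have h3 : r = p v := hvi.2.trans h1
        subst h3
        rw [if_pos hvi]
        omega
      · rw [if_neg hvi]
        omega

theorem replace_ofChain {n : ℕ} {M : ℕ → ℤ → ℕ} {v w : ℕ} {j : ℤ} (hM : Monotone M)
    (hv : v ≤ n) (hrow : M v j < M n j) (hw : w = (ofChain n M).ent j (M v j)) {T : Tab}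
    (hlam : T.lam = M n) (hrho : T.rho = addBox M v w j 0)
    (hent : ∀ r c, T.ent r c = if r = j ∧ c = M v j then v else (ofChain n M).ent r c) :
    T = ofChain n (addBox M v w j) := by
  have hwn : w ≤ n := hw ▸ ofChain_ent_le hM
  have hiff : ∀ i, w ≤ i ↔ M v j < M i j := fun i => by
    rw [hw]; exact ofChain_ent_le_iff hM hrow i
  have hlt : ∀ i < w, M i j ≤ M v j := fun i hi => by
    have := hiff i
    omega
  have hn : addBox M v w j n = M n := by
    funext r
    simp only [addBox]
    grind
  refine eq_ofChain (addBox_mono hM ((hiff w).1 le_rfl) hlt) (by rw [hn, hlam]) hrho ?_ ?_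
  · intro r c hc
    rw [hn] at hc
    rw [hent, if_neg (by grind), ofChain_ent_of_le hc]
  · intro r c hc
    rw [hn] at hc
    rw [hent]
    split_ifs with h
    · obtain ⟨rfl, rfl⟩ := h
      refine ⟨hv, fun i hi => ?_⟩
      have h1 := hiff i
      simp only [addBox]
      constructor
      · intro hvi
        have := level_le hM hvi r
        grind
      · intro h2
        by_contra! h3
        have := level_le hM h3.le r
        grind
    · refine ⟨ofChain_ent_le hM, fun i hi => ?_⟩
      rw [ofChain_ent_le_iff hM hc]
      simp only [addBox]
      by_cases hvi : v ≤ i ∧ i < w ∧ r = j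
      · have h2 := level_le hM hvi.1 j
        have h3 := hlt i hvi.2.1
        obtain ⟨-, -, rfl⟩ := hvi
        grind
      · rw [if_neg hvi]
        omega

theorem bump_ofChain {n : ℕ} (fuel : ℕ) : ∀ {M : ℕ → ℤ → ℕ} {v : ℕ} {p : ℕ → ℤ}, Monotone M →
    IsPath M v p → 1 ≤ v → v ≤ n → (∀ r, p v + fuel ≤ r → M n r = 0) →
    bump (fuel + 1) (ofChain n M) (p v) v = ofChain n (addPath M v p) := by
  have hmem : ∀ {M : ℕ → ℤ → ℕ} {v : ℕ} {j : ℤ}, Monotone M → ∀ c,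
      c ∈ ((Finset.Ico ((ofChain n M).rho j) ((ofChain n M).lam j)).filter
        fun c => v < (ofChain n M).ent j c) ↔ M v j ≤ c ∧ c < M n j := by
    intro M v j hM c
    simp only [Finset.mem_filter, Finset.mem_Ico]
    change (M 0 j ≤ c ∧ c < M n j) ∧ _ ↔ _
    have h0 := level_le hM (Nat.zero_le v) j
    constructor
    · rintro ⟨⟨h1, h2⟩, h3⟩
      have := ofChain_ent_le_iff hM h2 v
      omega
    · rintro ⟨h1, h2⟩
      have := ofChain_ent_le_iff hM h2 v
      omega
  have happ : ∀ {f : ℕ} {M : ℕ → ℤ → ℕ} {v : ℕ} {p : ℕ → ℤ}, Monotone M → IsPath M v p →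
      1 ≤ v → v ≤ n → M n (p v) ≤ M v (p v) →
      bump (f + 1) (ofChain n M) (p v) v = ofChain n (addPath M v p) := by
    intro f M v p hM hp hv1 hv hrow
    rw [bump]
    rw [dif_neg]
    · refine append_ofChain hM hp hv hrow rfl ?_ fun r c => rfl
      funext r
      simp [addPath, ofChain, show v ≠ 0 by omega]
    · rintro ⟨c, hc⟩
      rw [hmem hM] at hc
      omega
  induction fuel with
  | zero =>
    intro M v p hM hp hv1 hv h0
    exact happ hM hp hv1 hv (by rw [h0 _ (by simp)]; exact Nat.zero_le _)
  | succ fuel ih =>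
    intro M v p hM hp hv1 hv h0
    rcases Nat.lt_or_ge (M v (p v)) (M n (p v)) with hrow | hrow
    · have hne : ((Finset.Ico ((ofChain n M).rho (p v)) ((ofChain n M).lam (p v))).filter
          fun c => v < (ofChain n M).ent (p v) c).Nonempty :=
        ⟨M v (p v), (hmem hM _).2 ⟨le_rfl, hrow⟩⟩
      have hmin : Finset.min' _ hne = M v (p v) :=
        le_antisymm (Finset.min'_le _ _ ((hmem hM _).2 ⟨le_rfl, hrow⟩))
          (Finset.le_min' _ _ _ fun c hc => ((hmem hM c).1 hc).1)
      rw [bump]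
      rw [dif_pos hne]
      simp only [hmin]
      obtain ⟨w, hw⟩ : ∃ w, w = (ofChain n M).ent (p v) (M v (p v)) := ⟨_, rfl⟩
      have hiff : ∀ i, w ≤ i ↔ M v (p v) < M i (p v) := fun i => by
        rw [hw]; exact ofChain_ent_le_iff hM hrow i
      have hlt : ∀ i < w, M i (p v) ≤ M v (p v) := fun i hi => by
        have := hiff i
        omega
      have hvw : v ≤ w := by
        have := hiff v
        omega
      have hpw := hp.jump hM ((hiff w).1 le_rfl) hlt
      have hwn : w ≤ n := (hiff n).2 hrow
      rw [← hw, ← hpw, ← addPath_addBox hM hvw hp hlt,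
        ← ih (addBox_mono hM ((hiff w).1 le_rfl) hlt) (hp.addBox hvw) (by omega) hwn]
      · congr 1
        refine replace_ofChain hM hv hrow hw rfl ?_ fun r c => rfl
        funext r
        simp [addBox, ofChain, show v ≠ 0 by omega]
      · intro r hr
        simp only [addBox]
        rw [if_neg (by omega), h0 r (by push_cast; omega)]
    · exact happ hM hp hv1 hv hrow

/-- The rows of the boxes added by an internal insertion at row `r`. -/
def insPath (M : ℕ → ℤ → ℕ) (r : ℤ) : ℕ → ℤ
  | 0 => r
  | i + 1 => if M i (insPath M r i) < M (i + 1) (insPath M r i) then insPath M r i + 1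
      else insPath M r i

theorem isPath_insPath (M : ℕ → ℤ → ℕ) (r : ℤ) : IsPath M 0 (insPath M r) :=
  fun _ _ => rfl

/-- The effect on chains of an internal insertion at row `r`. -/
def insChain (M : ℕ → ℤ → ℕ) (r : ℤ) : ℕ → ℤ → ℕ :=
  addPath M 0 (insPath M r)

/-- All rows but finitely many are empty. -/
def BddSupp (f : ℤ → ℕ) : Prop :=
  ∃ A B : ℤ, ∀ r, r < A ∨ B ≤ r → f r = 0

theorem insChain_bddSupp {M : ℕ → ℤ → ℕ} {n : ℕ} (h : BddSupp (M n)) (r : ℤ) :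
    BddSupp (insChain M r n) := by
  obtain ⟨A, B, h⟩ := h
  refine ⟨min A (insPath M r n), max B (insPath M r n + 1), fun r' hr' => ?_⟩
  simp only [insChain, addPath]
  rw [h r' (by omega), if_neg (by omega)]

theorem lam_eq_zero_of_rMax_le {T : Tab} (h : BddSupp T.lam) {r : ℤ} (hr : rMax T ≤ r) :
    T.lam r = 0 := by
  obtain ⟨A, B, h⟩ := h
  by_contra hne
  have hbdd : BddBelow {m : ℤ | ∀ r : ℤ, m ≤ r → T.lam r = 0} := by
    refine ⟨r, fun m hm => ?_⟩
    by_contra! hlt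
    exact hne (hm r hlt.le)
  have := Int.csInf_mem (s := {m : ℤ | ∀ r : ℤ, m ≤ r → T.lam r = 0})
    ⟨B, fun r hr => h r (Or.inr hr)⟩ hbdd
  exact hne (this r hr)

theorem lam_eq_zero_of_lt_rMin {T : Tab} (h : BddSupp T.lam) {r : ℤ} (hr : r < rMin T) :
    T.lam r = 0 := by
  obtain ⟨A, B, h⟩ := h
  by_contra hne
  have hbdd : BddAbove {m : ℤ | ∀ r : ℤ, r < m → T.lam r = 0} := by
    refine ⟨r, fun m hm => ?_⟩
    by_contra! hlt
    exact hne (hm r hlt)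
  have := Int.csSup_mem (s := {m : ℤ | ∀ r : ℤ, r < m → T.lam r = 0})
    ⟨A, fun r hr => h r (Or.inl hr)⟩ hbdd
  exact hne (this r hr)

theorem intIns_ofChain {n : ℕ} {M : ℕ → ℤ → ℕ} (hM : Monotone M) (hs : BddSupp (M n)) (r : ℤ) :
    intIns (ofChain n M) r = ofChain n (insChain M r) := by
  have hp := isPath_insPath M r
  have hr0 : insPath M r 0 = r := rfl
  rw [intIns]
  split_ifs with hrow
  · change M 0 r < M n r at hrow
    obtain ⟨w, hw⟩ : ∃ w, w = (ofChain n M).ent r (M 0 r) := ⟨_, rfl⟩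
    have hiff : ∀ i, w ≤ i ↔ M 0 r < M i r := fun i => by
      rw [hw]; exact ofChain_ent_le_iff hM hrow i
    have hlt : ∀ i < w, M i (insPath M r 0) ≤ M 0 (insPath M r 0) := fun i hi => by
      have := hiff i
      rw [hr0]
      omega
    have hw1 : 1 ≤ w := by
      have := hiff 0
      omega
    have hpw := hp.jump hM ((hiff w).1 le_rfl) hlt
    rw [hr0] at hpw
    have hwn : w ≤ n := (hiff n).2 hrow
    have hent : (ofChain n M).ent r ((ofChain n M).rho r) = w := hw.symm
    rw [insChain, ← addPath_addBox hM (Nat.zero_le w) hp hlt, hent, ← hpw, hr0,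
      ← bump_ofChain ((rMax (ofChain n M) - r).toNat + 1)
        (addBox_mono hM ((hiff w).1 le_rfl) hlt) (hp.addBox (Nat.zero_le w)) hw1 hwn]
    · congr 1
      refine replace_ofChain hM (Nat.zero_le n) hrow hw rfl ?_ fun r c => rfl
      funext r'
      simp only [addBox, ofChain]
      grind
    · intro r' hr'
      simp only [addBox]
      rw [if_neg (by omega)]
      refine lam_eq_zero_of_rMax_le (T := ofChain n M) hs ?_
      push_cast at hr'
      omega
  · change ¬ (M 0 r < M n r) at hrow
    have h0 : M 0 r = M n r := by
      have := level_le hM (Nat.zero_le n) r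
      omega
    refine append_ofChain (v := 0) hM hp (Nat.zero_le n) (by rw [hr0]; omega) rfl ?_ ?_
    · funext r'
      simp only [addPath, ofChain, hr0]
      grind
    · intro r' c
      simp only
      split_ifs with h
      · obtain ⟨rfl, rfl⟩ := h
        exact ofChain_ent_of_le le_rfl
      · rfl

theorem insChain_mono {M : ℕ → ℤ → ℕ} (hM : Monotone M) (r : ℤ) : Monotone (insChain M r) :=
  addPath_mono hM (isPath_insPath M r)

theorem foldl_insChain_mono (L : List ℤ) : ∀ {M : ℕ → ℤ → ℕ}, Monotone M →
    Monotone (L.foldl insChain M) := by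
  induction L with
  | nil => exact fun hM => hM
  | cons j L ih => exact fun hM => ih (insChain_mono hM j)

theorem foldl_insChain_bddSupp {n : ℕ} (L : List ℤ) : ∀ {M : ℕ → ℤ → ℕ}, BddSupp (M n) →
    BddSupp (L.foldl insChain M n) := by
  induction L with
  | nil => exact fun hs => hs
  | cons j L ih => exact fun hs => ih (insChain_bddSupp hs j)

theorem foldl_intIns_ofChain {n : ℕ} (L : List ℤ) : ∀ {M : ℕ → ℤ → ℕ}, Monotone M →
    BddSupp (M n) → L.foldl intIns (ofChain n M) = ofChain n (L.foldl insChain M) := by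
  induction L with
  | nil => exact fun _ _ => rfl
  | cons j L ih =>
    intro M hM hs
    rw [List.foldl_cons, List.foldl_cons, intIns_ofChain hM hs,
      ih (insChain_mono hM j) (insChain_bddSupp hs j)]

/-- Add a box in row `j`. -/
def addAt (f : ℤ → ℕ) (j : ℤ) : ℤ → ℕ :=
  fun r => f r + if r = j then 1 else 0

/-- The rows of the boxes added to `α` when boxes are successively added to `μ` in the
rows of a list. -/
def bumpRows : (ℤ → ℕ) → (ℤ → ℕ) → List ℤ → List ℤ
  | _, _, [] => []
  | μ, α, j :: L => (if μ j < α j then j + 1 else j) ::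
      bumpRows (addAt μ j) (addAt α (if μ j < α j then j + 1 else j)) L

/-- The symmetric local growth rule. -/
def localRule (μ α β : ℤ → ℕ) : ℤ → ℕ :=
  fun r => max (α r) (β r) + (min (α (r - 1)) (β (r - 1)) - μ (r - 1))

theorem localRule_comm (μ α β : ℤ → ℕ) : localRule μ α β = localRule μ β α := by
  funext r
  simp only [localRule, max_comm, min_comm]

theorem count_bumpRows (L : List ℤ) : ∀ {μ α : ℤ → ℕ}, (∀ r, μ r ≤ α r) → L.Pairwise (· ≥ ·) →
    ∀ r, α r + (bumpRows μ α L).count r = localRule μ α (fun r => μ r + L.count r) r := by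
  induction L with
  | nil =>
    intro μ α h _ r
    have h1 := h r
    have h2 := h (r - 1)
    simp [bumpRows, localRule, h1, h2]
  | cons j L ih =>
    intro μ α h hL r
    rw [List.pairwise_cons] at hL
    have hc : ∀ r, j < r → L.count r = 0 := fun r hr => by
      rw [List.count_eq_zero]
      intro hmem
      have := hL.1 r hmem
      omega
    have hj := h j
    have hr := h r
    have hr1 := h (r - 1)
    have hle : ∀ r, addAt μ j r ≤ addAt α (if μ j < α j then j + 1 else j) r := by
      intro r
      have := h r
      simp only [addAt]
      grind
    have key := ih hle hL.2 r
    have hc1 := hc r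
    have hc2 := hc (r - 1)
    simp only [localRule, addAt] at key
    simp only [bumpRows, localRule, List.count_cons, beq_iff_eq]
    rcases lt_trichotomy r j with h1 | rfl | h1
    · by_cases hlt : μ j < α j <;> simp only [hlt, if_true, if_false] at key ⊢ <;>
        split_ifs at key ⊢ <;> omega
    · by_cases hlt : μ r < α r <;> simp only [hlt, if_true, if_false] at key ⊢ <;>
        split_ifs at key ⊢ <;> omega
    · rcases eq_or_ne r (j + 1) with rfl | h2
      · simp only [add_sub_cancel_right] at key hr1 ⊢
        by_cases hlt : μ j < α j <;> simp only [hlt, if_true, if_false] at key ⊢ <;>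
          split_ifs at key ⊢ <;> omega
      · by_cases hlt : μ j < α j <;> simp only [hlt, if_true, if_false] at key ⊢ <;>
          split_ifs at key ⊢ <;> omega

theorem le_of_mem_bumpRows (L : List ℤ) {μ α : ℤ → ℕ} {b : ℤ} (h : ∀ r, μ r ≤ α r)
    (hL : L.Pairwise (· ≥ ·)) (hb : ∀ x ∈ L, x ≤ b) (hb' : α b ≤ μ b ∨ ∀ x ∈ L, x < b) :
    ∀ x ∈ bumpRows μ α L, x ≤ b := by
  intro x hx
  by_contra! hlt
  have hpos := List.count_pos_iff.2 hx
  have hcount := count_bumpRows L h hL x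
  have h0 : L.count x = 0 := by
    rw [List.count_eq_zero]
    intro hmem
    have := hb x hmem
    omega
  have h1 := h x
  have h2 := h (x - 1)
  simp only [localRule, h0] at hcount
  have h3 : α (x - 1) ≤ μ (x - 1) ∨ L.count (x - 1) = 0 := by
    rcases eq_or_ne (x - 1) b with h4 | h4
    · rw [h4]
      refine hb'.imp_right fun h5 => List.count_eq_zero.2 fun hmem => ?_
      exact lt_irrefl _ (h5 b hmem)
    · right
      rw [List.count_eq_zero]
      intro hmem
      have := hb _ hmem
      omega
  omega

theorem pairwise_bumpRows (L : List ℤ) : ∀ {μ α : ℤ → ℕ}, (∀ r, μ r ≤ α r) →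
    L.Pairwise (· ≥ ·) → (bumpRows μ α L).Pairwise (· ≥ ·) := by
  induction L with
  | nil => exact fun _ _ => List.Pairwise.nil
  | cons j L ih =>
    intro μ α h hL
    rw [List.pairwise_cons] at hL
    have hle : ∀ r, addAt μ j r ≤ addAt α (if μ j < α j then j + 1 else j) r := by
      intro r
      have := h r
      simp only [addAt]
      grind
    rw [bumpRows, List.pairwise_cons]
    refine ⟨le_of_mem_bumpRows L hle hL.2 ?_ ?_, ih hle hL.2⟩
    · intro x hx
      have := hL.1 x hx
      split_ifs <;> omega
    · split_ifs with hj
      · right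
        intro x hx
        have := hL.1 x hx
        omega
      · left
        simp only [addAt]
        simp only [if_true]
        omega

/-- The rows of the boxes added at each level by successive internal insertions. -/
def levelRows (M : ℕ → ℤ → ℕ) (L : List ℤ) : ℕ → List ℤ
  | 0 => L
  | i + 1 => bumpRows (M i) (M (i + 1)) (levelRows M L i)

theorem insChain_apply (M : ℕ → ℤ → ℕ) (j : ℤ) (i : ℕ) :
    insChain M j i = addAt (M i) (insPath M j i) := by
  funext r
  simp [insChain, addPath, addAt]

theorem levelRows_nil (M : ℕ → ℤ → ℕ) (i : ℕ) : levelRows M [] i = [] := by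
  induction i with
  | zero => rfl
  | succ i ih => rw [levelRows, ih, bumpRows]

theorem levelRows_cons (M : ℕ → ℤ → ℕ) (j : ℤ) (L : List ℤ) (i : ℕ) :
    levelRows M (j :: L) i = insPath M j i :: levelRows (insChain M j) L i := by
  induction i with
  | zero => rfl
  | succ i ih =>
    rw [levelRows, ih, bumpRows, levelRows, insChain_apply, insChain_apply]
    rfl

theorem pairwise_levelRows {M : ℕ → ℤ → ℕ} (hM : Monotone M) {L : List ℤ}
    (hL : L.Pairwise (· ≥ ·)) (i : ℕ) : (levelRows M L i).Pairwise (· ≥ ·) := by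
  induction i with
  | zero => exact hL
  | succ i ih => exact pairwise_bumpRows _ (fun r => level_le hM (Nat.le_succ i) r) ih

theorem foldl_insChain_apply (L : List ℤ) : ∀ (M : ℕ → ℤ → ℕ) (i : ℕ) (r : ℤ),
    L.foldl insChain M i r = M i r + (levelRows M L i).count r := by
  induction L with
  | nil =>
    intro M i r
    rw [levelRows_nil]
    rfl
  | cons j L ih =>
    intro M i r
    rw [List.foldl_cons, ih, levelRows_cons, List.count_cons, insChain_apply]
    simp only [addAt, beq_iff_eq]
    grind

/-- The chain obtained from `M` by starting with `β` and applying the local rule. -/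
def grow (M : ℕ → ℤ → ℕ) (β : ℤ → ℕ) : ℕ → ℤ → ℕ
  | 0 => β
  | i + 1 => localRule (M i) (M (i + 1)) (grow M β i)

theorem foldl_insChain_eq_grow {M : ℕ → ℤ → ℕ} (hM : Monotone M) {L : List ℤ}
    (hL : L.Pairwise (· ≥ ·)) :
    L.foldl insChain M = grow M fun r => M 0 r + L.count r := by
  funext i
  induction i with
  | zero =>
    funext r
    rw [foldl_insChain_apply]
    rfl
  | succ i ih =>
    funext r
    rw [grow, ← ih, foldl_insChain_apply, levelRows,
      count_bumpRows _ (fun r => level_le hM (Nat.le_succ i) r) (pairwise_levelRows hM hL i)]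
    congr 1
    funext r
    rw [foldl_insChain_apply]

theorem foldl_iterate {α β : Type*} (f : α → β → α) (k : β → ℕ) (l : List β) : ∀ a : α,
    l.foldl (fun a b => (fun a' => f a' b)^[k b] a) a =
      (l.flatMap fun b => List.replicate (k b) b).foldl f a := by
  have hrep : ∀ (m : ℕ) (b : β) (a : α),
      (List.replicate m b).foldl f a = (fun a' => f a' b)^[m] a := by
    intro m b
    induction m with
    | zero => exact fun _ => rfl
    | succ m ih =>
      intro a
      rw [List.replicate_succ, List.foldl_cons, ih, Function.iterate_succ_apply]
  induction l with
  | nil => exact fun _ => rfl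
  | cons b l ih =>
    intro a
    rw [List.flatMap_cons, List.foldl_append, hrep, List.foldl_cons, ih]

/-- The rows of the `1`-cells of `Q`, in weakly decreasing order. -/
noncomputable def oneRows (Q : Tab) : List ℤ :=
  ((List.range (rMax Q - rMin Q).toNat).map fun t : ℕ => rMax Q - 1 - (t : ℤ)).flatMap
    fun r => List.replicate (ones Q r) r

theorem pairwise_oneRows (Q : Tab) : (oneRows Q).Pairwise (· ≥ ·) := by
  rw [oneRows, List.pairwise_flatMap]
  constructor
  · intro r _
    rw [List.pairwise_replicate]
    exact Or.inr le_rfl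
  · rw [List.pairwise_map]
    refine List.pairwise_lt_range.imp fun {s t} hst x hx y hy => ?_
    rw [List.eq_of_mem_replicate hx, List.eq_of_mem_replicate hy]
    omega

theorem count_flatMap_replicate (k : ℤ → ℕ) (r : ℤ) (l : List ℤ) : l.Nodup →
    (l.flatMap fun s => List.replicate (k s) s).count r = if r ∈ l then k r else 0 := by
  induction l with
  | nil => simp
  | cons s l ih =>
    intro h
    rw [List.nodup_cons] at h
    rw [List.flatMap_cons, List.count_append, ih h.2, List.count_replicate]
    simp only [beq_iff_eq, List.mem_cons]
    grind

theorem count_oneRows {Q : Tab} (hs : BddSupp Q.lam) (r : ℤ) :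
    (oneRows Q).count r = ones Q r := by
  rw [oneRows, count_flatMap_replicate]
  · split_ifs with h
    · rfl
    · have h0 : Q.lam r = 0 := by
        by_contra hne
        have h1 : r < rMax Q := by
          by_contra! h2
          exact hne (lam_eq_zero_of_rMax_le hs h2)
        have h2 : rMin Q ≤ r := by
          by_contra! h2
          exact hne (lam_eq_zero_of_lt_rMin hs h2)
        refine h (List.mem_map.2 ⟨(rMax Q - 1 - r).toNat, List.mem_range.2 (by omega), by omega⟩)
      simp [ones, h0]
  · refine List.Nodup.map (fun s t hst => ?_) List.nodup_range
    omega

theorem ones_ofChain {n : ℕ} {K : ℕ → ℤ → ℕ} (hK : Monotone K) (hn : 1 ≤ n) (r : ℤ) :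
    K 0 r + ones (ofChain n K) r = K 1 r := by
  have h01 := level_le hK (Nat.zero_le 1) r
  have h1n := level_le hK hn r
  have : ones (ofChain n K) r = (Finset.Ico (K 0 r) (K 1 r)).card := by
    rw [ones]
    congr 1
    ext c
    simp only [Finset.mem_filter, Finset.mem_Ico]
    change (K 0 r ≤ c ∧ c < K n r) ∧ _ ↔ _
    constructor
    · rintro ⟨⟨h1, h2⟩, h3⟩
      have := ofChain_ent_le_iff hK h2 1
      omega
    · rintro ⟨h1, h2⟩
      have h3 := ofChain_ent_le_iff hK (show c < K n r by omega) 1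
      have h4 := ofChain_ent_le_iff hK (show c < K n r by omega) 0
      omega
  rw [this, Nat.card_Ico]
  omega

/-- Drop the first level of a chain and use `γ` as the last one. -/
def cycleChain (n : ℕ) (K : ℕ → ℤ → ℕ) (γ : ℤ → ℕ) : ℕ → ℤ → ℕ :=
  fun i => if i < n then K (i + 1) else γ

theorem cycleChain_mono {n : ℕ} {K : ℕ → ℤ → ℕ} (hK : Monotone K) {γ : ℤ → ℕ} (h : K n ≤ γ) :
    Monotone (cycleChain n K γ) := by
  refine monotone_nat_of_le_succ fun i => ?_
  simp only [cycleChain]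
  split_ifs with h1 h2
  · exact hK (by omega)
  · exact (hK (by omega)).trans h
  · omega
  · exact le_rfl

theorem iota2_ofChain {n : ℕ} (hn : 1 ≤ n) {M K : ℕ → ℤ → ℕ} (hM : Monotone M) (hK : Monotone K)
    (hs : BddSupp (M n)) (h0 : M 0 = K 0) (h1 : M n = K n) :
    iota2 n (ofChain n M, ofChain n K) =
        (ofChain n (grow M (K 1)), ofChain n (cycleChain n K (grow M (K 1) n))) ∧
      Monotone (grow M (K 1)) ∧ Monotone (cycleChain n K (grow M (K 1) n)) ∧
      BddSupp (grow M (K 1) n) := by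
  have hgrow : (oneRows (ofChain n K)).foldl insChain M = grow M (K 1) := by
    rw [foldl_insChain_eq_grow hM (pairwise_oneRows _)]
    congr 1
    funext r
    rw [count_oneRows (Q := ofChain n K) (by change BddSupp (K n); rwa [← h1]), h0,
      ones_ofChain hK hn]
  have hmono : Monotone (grow M (K 1)) := hgrow ▸ foldl_insChain_mono _ hM
  have hKn : K n ≤ grow M (K 1) n := by
    intro r
    rw [← h1, ← hgrow, foldl_insChain_apply]
    exact Nat.le_add_right _ _
  have hcyc := cycleChain_mono hK hKn
  refine ⟨?_, hmono, hcyc, hgrow ▸ foldl_insChain_bddSupp _ hs⟩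
  have hfst : (iota2 n (ofChain n M, ofChain n K)).1 = ofChain n (grow M (K 1)) := by
    rw [← hgrow, ← foldl_intIns_ofChain _ hM hs, oneRows, ← foldl_iterate]
    simp only [iota2]
    congr 1
    simp [← List.map_eq_flatMap, Function.comp_def]
  refine Prod.ext hfst ?_
  have hlam : (iota2 n (ofChain n M, ofChain n K)).2.lam = grow M (K 1) n :=
    congrArg Tab.lam hfst
  have hrho : (iota2 n (ofChain n M, ofChain n K)).2.rho = K 1 :=
    congrArg Tab.rho hfst
  have hn0 : ¬ n < n := lt_irrefl n
  have hent : ∀ r c, (iota2 n (ofChain n M, ofChain n K)).2.ent r c =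
      if K 1 r ≤ c ∧ c < grow M (K 1) n r then
        if K 1 r ≤ c ∧ c < K n r then (ofChain n K).ent r c - 1 else n
      else 0 := by
    intro r c
    rw [← hlam, ← hrho]
    conv_rhs => enter [2, 1]; rw [hrho, ← ones_ofChain hK hn r]
    rfl
  refine eq_ofChain hcyc ?_ ?_ ?_ ?_
  · simp [hlam, cycleChain]
  · simp [hrho, cycleChain, show 0 < n by omega]
  · intro r c hc
    simp only [cycleChain, if_neg hn0] at hc
    rw [hent, if_neg (by omega)]
  · intro r c hc
    simp only [cycleChain, if_neg hn0] at hc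
    have h1n := level_le hK hn r
    rw [hent]
    split_ifs with h2 h3
    · have h4 := ofChain_ent_le hK (n := n) (r := r) (c := c)
      have h5 := ofChain_ent_le_iff hK h3.2
      refine ⟨by omega, fun i hi => ?_⟩
      have h6 := h5 (i + 1)
      have h7 := h5 n
      have h8 := h5 1
      simp only [cycleChain]
      split_ifs with h9
      · omega
      · omega
    · refine ⟨le_rfl, fun i hi => ?_⟩
      simp only [cycleChain]
      split_ifs with h9
      · have := level_le hK (show i + 1 ≤ n by omega) r
        omega
      · omega
    · refine ⟨Nat.zero_le n, fun i hi => ?_⟩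
      simp only [cycleChain]
      split_ifs with h9
      · have := level_le hK (show 1 ≤ i + 1 by omega) r
        omega
      · omega

theorem exists_chain {n : ℕ} {T : Tab} (hT : isSSYT n T) :
    ∃ M : ℕ → ℤ → ℕ, Monotone M ∧ BddSupp (M n) ∧ T = ofChain n M := by
  obtain ⟨⟨r0, N, hlow, -, hhigh, hle⟩, hsh, hn, hrow, -⟩ := hT
  let M : ℕ → ℤ → ℕ := fun i r =>
    T.rho r + ((Finset.Ico (T.rho r) (T.lam r)).filter fun c => T.ent r c ≤ i).card
  have hM : Monotone M := by
    intro i k hik r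
    refine Nat.add_le_add_left (Finset.card_le_card fun c => ?_) _
    simp only [Finset.mem_filter]
    exact fun h => ⟨h.1, h.2.trans hik⟩
  have hMn : T.lam = M n := by
    funext r
    have := hle r
    simp only [M]
    rw [Finset.filter_true_of_mem fun c _ => hn r c, Nat.card_Ico]
    omega
  have hM0 : T.rho = M 0 := by
    funext r
    simp only [M]
    rw [Finset.filter_false_of_mem, Finset.card_empty, add_zero]
    intro c hc
    rw [Finset.mem_Ico] at hc
    have := (hsh r c).2 hc
    omega
  have hzero : ∀ r c, ¬ inSh T r c → T.ent r c = 0 := fun r c h => by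
    by_contra hne
    exact h ((hsh r c).1 hne)
  refine ⟨M, hM, ⟨r0, N, fun r hr => ?_⟩, eq_ofChain hM hMn hM0 ?_ ?_⟩
  · rw [← hMn]
    exact hr.elim (fun h => (hlow r h).1) (hhigh r)
  · intro r c hc
    rw [← hMn] at hc
    exact hzero r c fun h => by have := h.2; omega
  · intro r c hc
    rw [← hMn] at hc
    refine ⟨hn r c, fun i _ => ?_⟩
    rcases Nat.lt_or_ge c (T.rho r) with h1 | h1
    · rw [hzero r c fun h => by have := h.1; omega]
      simp only [Nat.zero_le, true_iff, M]
      omega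
    · constructor
      · intro h2
        have hsub : Finset.Ico (T.rho r) (c + 1) ⊆
            (Finset.Ico (T.rho r) (T.lam r)).filter fun c => T.ent r c ≤ i := by
          intro d hd
          simp only [Finset.mem_filter, Finset.mem_Ico] at hd ⊢
          have := hrow r d c hd.1 (by omega) hc
          omega
        have := Finset.card_le_card hsub
        rw [Nat.card_Ico] at this
        simp only [M]
        omega
      · intro h2
        by_contra! h3
        have hsub : (Finset.Ico (T.rho r) (T.lam r)).filter (fun c => T.ent r c ≤ i) ⊆
            Finset.Ico (T.rho r) c := by
          intro d hd
          simp only [Finset.mem_filter, Finset.mem_Ico] at hd ⊢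
          by_contra! h4
          have := hrow r c d h1 (h4 hd.1.1) hd.1.2
          omega
        have := Finset.card_le_card hsub
        rw [Nat.card_Ico] at this
        simp only [M] at h2
        omega

theorem iota2_zero {P Q : Tab} (hQ : isSSYT 0 Q)
    (hsh : P.lam = Q.lam ∧ P.rho = Q.rho) : iota2 0 (P, Q) = (P, Q) := by
  have hQ0 : ∀ r c, Q.ent r c = 0 := fun r c => Nat.le_zero.1 (hQ.2.2.1 r c)
  have hones : ∀ r, ones Q r = 0 := fun r => by simp [ones, hQ0]
  have hfst : (iota2 0 (P, Q)).1 = P := by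
    simp only [iota2, hones]
    exact List.foldl_fixed _
  refine Prod.ext hfst ?_
  have hlam : (iota2 0 (P, Q)).2.lam = Q.lam := (congrArg Tab.lam hfst).trans hsh.1
  have hrho : (iota2 0 (P, Q)).2.rho = Q.rho := (congrArg Tab.rho hfst).trans hsh.2
  have hent : (iota2 0 (P, Q)).2.ent = Q.ent := by
    funext r c
    simp [iota2, hQ0]
  change (iota2 0 (P, Q)).2 = Q
  cases Q
  simp only at hlam hrho hent
  rw [Tab.mk.injEq]
  exact ⟨hlam, hrho, hent⟩

theorem grow_cycleChain {n : ℕ} {K : ℕ → ℤ → ℕ} {γ β : ℤ → ℕ} {i : ℕ} (hi : i < n) :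
    grow (cycleChain n K γ) (grow K β 1) i = grow K β (i + 1) := by
  induction i with
  | zero => rfl
  | succ i ih =>
    rw [grow, ih (by omega), cycleChain, cycleChain, if_pos (by omega), if_pos hi]
    rfl

theorem grow_cycleChain_last {n : ℕ} (hn : 1 ≤ n) {K : ℕ → ℤ → ℕ} {γ β : ℤ → ℕ} :
    grow (cycleChain n K γ) (grow K β 1) n = localRule (K n) γ (grow K β n) := by
  obtain ⟨m, rfl⟩ : ∃ m, n = m + 1 := ⟨n - 1, by omega⟩
  rw [grow, grow_cycleChain (Nat.lt_succ_self m), cycleChain, cycleChain,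
    if_pos (Nat.lt_succ_self m), if_neg (lt_irrefl _)]

/-- The internal insertions with cycling commute: `ι₁ ∘ ι₂ = ι₂ ∘ ι₁` on pairs of
semistandard skew tableaux of the same shape. -/
theorem iota_commute (n : ℕ) (P Q : Tab)
    (hP : isSSYT n P) (hQ : isSSYT n Q)
    (hsh : P.lam = Q.lam ∧ P.rho = Q.rho) :
    iota1 n (iota2 n (P, Q)) = iota2 n (iota1 n (P, Q)) := by
  rcases Nat.eq_zero_or_pos n with rfl | hn
  · have h1 := iota2_zero hQ hsh
    have h2 : iota1 0 (P, Q) = (P, Q) := by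
      simp only [iota1, swapP]
      rw [iota2_zero hP ⟨hsh.1.symm, hsh.2.symm⟩]
    rw [h1, h2, h1]
  obtain ⟨M, hM, hMs, rfl⟩ := exists_chain hP
  obtain ⟨K, hK, hKs, rfl⟩ := exists_chain hQ
  obtain ⟨hl, h0⟩ := hsh
  change M n = K n at hl
  change M 0 = K 0 at h0
  have hc0 : ∀ (A : ℕ → ℤ → ℕ) (γ : ℤ → ℕ), cycleChain n A γ 0 = A 1 := fun A γ => if_pos hn
  have hcn : ∀ (A : ℕ → ℤ → ℕ) (γ : ℤ → ℕ), cycleChain n A γ n = γ := fun A γ =>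
    if_neg (lt_irrefl n)
  obtain ⟨e1, m1, k1, s1⟩ := iota2_ofChain hn hM hK hMs h0 hl
  obtain ⟨e2, m2, k2, s2⟩ := iota2_ofChain hn hK hM hKs h0.symm hl.symm
  obtain ⟨e3, -⟩ := iota2_ofChain hn k1 m1 (by rwa [hcn]) (hc0 _ _) (hcn _ _)
  obtain ⟨e4, -⟩ := iota2_ofChain hn k2 m2 (by rwa [hcn]) (hc0 _ _) (hcn _ _)
  have hone : grow M (K 1) 1 = grow K (M 1) 1 := by
    change localRule (M 0) (M 1) (K 1) = localRule (K 0) (K 1) (M 1)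
    rw [h0, localRule_comm]
  have hlast : grow (cycleChain n K (grow M (K 1) n)) (grow M (K 1) 1) n =
      grow (cycleChain n M (grow K (M 1) n)) (grow K (M 1) 1) n := by
    rw [hone, grow_cycleChain_last hn, ← hone, grow_cycleChain_last hn, hl, localRule_comm]
  simp only [iota1, swapP, e1, e2, e3, e4]
  refine Prod.ext (ofChain_congr fun i hi => ?_) (ofChain_congr fun i hi => ?_)
  · rcases hi.lt_or_eq with hlt | rfl
    · rw [← hone, grow_cycleChain hlt, cycleChain, if_pos hlt]
    · rw [hcn, hlast]
  · rcases hi.lt_or_eq with hlt | rfl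
    · rw [hone, grow_cycleChain hlt, cycleChain, if_pos hlt]
    · rw [hcn, hlast]
end
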